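/- Let A ∈ ℝ^{n×N}, τ, λ > 0, Y ∈ ℝ^{n×m}, L ≥ 2, B_out > 0, and let M₂ = {σ(Ψ f_Φ^L(Y)) ∈ ℝ^{N×m} : Ψ, Φ ∈ O(N)} (σ applied columnwise). Then for every ε > 0, log N(M₂, ‖·‖_F, ε) ≤ N²·log(1 + 4M_L/ε) + nN·log(1 + 4‖A‖_{2→2}K_L/ε), where M_L = τ‖A‖_{2→2}‖Y‖_F Σ_{k=0}^{L−1} ‖I − τAᵀA‖_{2→2}^k and K_L = τ‖Y‖_F‖I − τAᵀA‖_{2→2}^{L−1} + τ‖Y‖_F Σ_{l=2}^{L} ‖I − τAᵀA‖_{2→2}^{L−l}(1 + 2τ‖A‖²_{2→2} Σ_{k=0}^{l−2} ‖I − τAᵀA‖_{2→2}^k). -/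

import Mathlib

open MeasureTheory Matrix
open scoped ENNReal

noncomputable def soft (mu x : ℝ) : ℝ := Real.sign x * max 0 (|x| - mu)

noncomputable def softMat {a b : ℕ} (mu : ℝ) (M : Matrix (Fin a) (Fin b) ℝ) :
    Matrix (Fin a) (Fin b) ℝ := Matrix.of fun i j => soft mu (M i j)

noncomputable def specNorm {a b : ℕ} (A : Matrix (Fin a) (Fin b) ℝ) : ℝ :=
  ‖LinearMap.toContinuousLinearMap (Matrix.toEuclideanLin A)‖

noncomputable def frobNorm {a b : ℕ} (A : Matrix (Fin a) (Fin b) ℝ) : ℝ :=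
  Real.sqrt (∑ i, ∑ j, (A i j) ^ 2)

noncomputable def l2 {N : ℕ} (x : Fin N → ℝ) : ℝ := Real.sqrt (∑ i, x i ^ 2)

noncomputable def sigma {N : ℕ} (B : ℝ) (x : Fin N → ℝ) : Fin N → ℝ :=
  if l2 x ≤ B then x else (B / l2 x) • x

noncomputable def sigmaMat {N m : ℕ} (B : ℝ) (M : Matrix (Fin N) (Fin m) ℝ) :
    Matrix (Fin N) (Fin m) ℝ := Matrix.of fun i j => sigma B (fun k => M k j) i

def IsOrthogonal {N : ℕ} (Φ : Matrix (Fin N) (Fin N) ℝ) : Prop := Φᵀ * Φ = 1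

noncomputable def ista {n N m : ℕ} (A : Matrix (Fin n) (Fin N) ℝ) (τ lam : ℝ)
    (Φ : Matrix (Fin N) (Fin N) ℝ) (Y : Matrix (Fin n) (Fin m) ℝ) :
    ℕ → Matrix (Fin N) (Fin m) ℝ
  | 0 => 0
  | l + 1 => softMat (τ * lam)
      ((1 - τ • (Φᵀ * Aᵀ * A * Φ)) * ista A τ lam Φ Y l + τ • ((A * Φ)ᵀ * Y))

noncomputable def istaVec {n N : ℕ} (A : Matrix (Fin n) (Fin N) ℝ) (τ lam : ℝ)
    (Φ : Matrix (Fin N) (Fin N) ℝ) (y : Fin n → ℝ) : ℕ → Fin N → ℝ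
  | 0 => 0
  | l + 1 => soft (τ * lam) ∘
      ((1 - τ • (Φᵀ * Aᵀ * A * Φ)) *ᵥ istaVec A τ lam Φ y l + τ • ((A * Φ)ᵀ *ᵥ y))

noncomputable def KL {n N m : ℕ} (A : Matrix (Fin n) (Fin N) ℝ) (τ : ℝ)
    (Y : Matrix (Fin n) (Fin m) ℝ) (L : ℕ) : ℝ :=
  τ * frobNorm Y * specNorm (1 - τ • (Aᵀ * A)) ^ (L - 1)
    + τ * frobNorm Y * ∑ l ∈ Finset.Icc 2 L,
        specNorm (1 - τ • (Aᵀ * A)) ^ (L - l) *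
          (1 + 2 * τ * specNorm A ^ 2 *
            ∑ k ∈ Finset.range (l - 1), specNorm (1 - τ • (Aᵀ * A)) ^ k)

noncomputable def ML {n N m : ℕ} (A : Matrix (Fin n) (Fin N) ℝ) (τ : ℝ)
    (Y : Matrix (Fin n) (Fin m) ℝ) (L : ℕ) : ℝ :=
  τ * specNorm A * frobNorm Y * ∑ k ∈ Finset.range L, specNorm (1 - τ • (Aᵀ * A)) ^ k

noncomputable def coveringNumber {α : Type*} (d : α → α → ℝ) (s : Set α) (ε : ℝ) : ℝ≥0∞ :=
  ⨅ (t : Finset α) (_ : ∀ x ∈ s, ∃ y ∈ t, d x y ≤ ε), (t.card : ℝ≥0∞)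

section covering

theorem card_separated_aux {E : Type*} [NormedAddCommGroup E] [NormedSpace ℝ E]
    [FiniteDimensional ℝ E] (R r : ℝ) (hR : 0 ≤ R) (hr : 0 < r) (s : Finset E)
    (hs : ∀ c ∈ s, ‖c‖ ≤ R)
    (h : ∀ c ∈ s, ∀ d ∈ s, c ≠ d → r ≤ ‖c - d‖) :
    (s.card : ℝ) ≤ (1 + 2 * R / r) ^ Module.finrank ℝ E := by
  borelize E
  let μ : Measure E := Measure.addHaar
  have δpos : 0 < r / 2 := by positivity
  have ρpos : 0 < R + r / 2 := by positivity
  have D : Set.Pairwise (s : Set E) (Function.onFun Disjoint fun c => Metric.ball (c : E) (r / 2)) := by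
    rintro c hc d hd hcd
    apply Metric.ball_disjoint_ball
    rw [dist_eq_norm]
    have := h c hc d hd hcd
    linarith
  have A_subset : (⋃ c ∈ s, Metric.ball (c : E) (r / 2)) ⊆ Metric.ball (0 : E) (R + r / 2) := by
    refine Set.iUnion₂_subset fun x hx => ?_
    apply Metric.ball_subset_ball'
    rw [dist_zero_right]
    have := hs x hx
    linarith
  have I :
    (s.card : ℝ≥0∞) * ENNReal.ofReal ((r / 2) ^ Module.finrank ℝ E) * μ (Metric.ball 0 1) ≤
      ENNReal.ofReal ((R + r / 2) ^ Module.finrank ℝ E) * μ (Metric.ball 0 1) :=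
    calc
      _ = μ (⋃ c ∈ s, Metric.ball (c : E) (r / 2)) := by
        rw [measure_biUnion_finset D fun c _ => measurableSet_ball]
        simp only [μ.addHaar_ball_of_pos _ δpos]
        simp only [Finset.sum_const, nsmul_eq_mul, mul_assoc]
      _ ≤ μ (Metric.ball (0 : E) (R + r / 2)) := measure_mono A_subset
      _ = _ := by
        simp only [μ.addHaar_ball_of_pos _ ρpos]
  have J := (ENNReal.mul_le_mul_iff_left (Metric.measure_ball_pos _ _ zero_lt_one).ne'
    measure_ball_lt_top.ne).1 I
  have K := ENNReal.toReal_le_of_le_ofReal (pow_nonneg ρpos.le _) J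
  rw [ENNReal.toReal_mul, ENNReal.toReal_natCast, ENNReal.toReal_ofReal (by positivity),
    ← le_div_iff₀ (by positivity), ← div_pow] at K
  have e : 1 + 2 * R / r = (R + r / 2) / (r / 2) := by field_simp; ring
  rw [e]
  exact K

theorem exists_cover_aux {E : Type*} [NormedAddCommGroup E] [NormedSpace ℝ E]
    [FiniteDimensional ℝ E] (S : Set E) (hS : S.Nonempty) (R c ε : ℝ) (hR : 0 ≤ R) (hc : 0 ≤ c)
    (hε : 0 < ε) (hSR : ∀ x ∈ S, ‖x‖ ≤ R) :
    ∃ t : Finset E, (∀ x ∈ t, x ∈ S) ∧ (∀ x ∈ S, ∃ y ∈ t, c * ‖x - y‖ ≤ ε) ∧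
      (t.card : ℝ) ≤ (1 + 2 * R * c / ε) ^ Module.finrank ℝ E := by
  classical
  rcases hc.eq_or_lt with rfl | hc
  · obtain ⟨x, hx⟩ := hS
    exact ⟨{x}, by simpa using hx, fun y _ => ⟨x, by simp, by simpa using hε.le⟩, by simp⟩
  have hr : 0 < ε / c := by positivity
  have key : ∀ t : Finset E, (∀ x ∈ t, x ∈ S) →
      (∀ x ∈ t, ∀ y ∈ t, x ≠ y → ε / c ≤ ‖x - y‖) →
      (t.card : ℝ) ≤ (1 + 2 * R * c / ε) ^ Module.finrank ℝ E := by
    intro t ht hs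
    have := card_separated_aux R (ε / c) hR hr t (fun x hx => hSR x (ht x hx)) hs
    convert this using 3
    field_simp
  by_contra hcon
  have all : ∀ k : ℕ, ∃ t : Finset E, (∀ x ∈ t, x ∈ S) ∧
      (∀ x ∈ t, ∀ y ∈ t, x ≠ y → ε / c ≤ ‖x - y‖) ∧ t.card = k := by
    intro k
    induction k with
    | zero => exact ⟨∅, by simp, by simp, by simp⟩
    | succ k ih =>
      obtain ⟨t, h1, h2, h3⟩ := ih
      have : ¬ ∀ x ∈ S, ∃ y ∈ t, c * ‖x - y‖ ≤ ε := fun h => hcon ⟨t, h1, h, key t h1 h2⟩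
      push Not at this
      obtain ⟨x, hx, hxt⟩ := this
      have hlt : ∀ y ∈ t, ε / c ≤ ‖x - y‖ := by
        intro y hy
        rw [div_le_iff₀ hc, mul_comm]
        exact (hxt y hy).le
      have hxn : x ∉ t := by
        intro hm
        have := hxt x hm
        simp at this
        linarith
      refine ⟨insert x t, ?_, ?_, ?_⟩
      · intro y hy
        rcases Finset.mem_insert.1 hy with rfl | hy
        · exact hx
        · exact h1 y hy
      · intro y hy z hz hyz
        rcases Finset.mem_insert.1 hy with hy' | hy' <;>
          rcases Finset.mem_insert.1 hz with hz' | hz'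
        · exact absurd (hy'.trans hz'.symm) hyz
        · rw [hy']; exact hlt z hz'
        · rw [hz', norm_sub_rev]; exact hlt y hy'
        · exact h2 y hy' z hz' hyz
      · rw [Finset.card_insert_of_notMem hxn, h3]
  obtain ⟨k, hk⟩ := exists_nat_gt ((1 + 2 * R * c / ε) ^ Module.finrank ℝ E)
  obtain ⟨t, h1, h2, h3⟩ := all k
  have := key t h1 h2
  rw [h3] at this
  linarith

end covering

section spec
open scoped Matrix.Norms.L2Operator

theorem specNorm_eq {a b : ℕ} (A : Matrix (Fin a) (Fin b) ℝ) : specNorm A = ‖A‖ := rfl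

theorem specNorm_nonneg {a b : ℕ} (A : Matrix (Fin a) (Fin b) ℝ) : 0 ≤ specNorm A := norm_nonneg _

theorem specNorm_mul {a b c : ℕ} (A : Matrix (Fin a) (Fin b) ℝ) (B : Matrix (Fin b) (Fin c) ℝ) :
    specNorm (A * B) ≤ specNorm A * specNorm B := Matrix.l2_opNorm_mul A B

theorem specNorm_add {a b : ℕ} (A B : Matrix (Fin a) (Fin b) ℝ) :
    specNorm (A + B) ≤ specNorm A + specNorm B := by
  simp only [specNorm_eq]; exact norm_add_le _ _

theorem specNorm_smul {a b : ℕ} (c : ℝ) (hc : 0 ≤ c) (A : Matrix (Fin a) (Fin b) ℝ) :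
    specNorm (c • A) = c * specNorm A := by
  simp only [specNorm_eq]; rw [norm_smul, Real.norm_of_nonneg hc]

theorem specNorm_sub_rev {a b : ℕ} (A B : Matrix (Fin a) (Fin b) ℝ) :
    specNorm (A - B) = specNorm (B - A) := by
  simp only [specNorm_eq]; exact norm_sub_rev _ _

theorem specNorm_transpose {a b : ℕ} (A : Matrix (Fin a) (Fin b) ℝ) :
    specNorm Aᵀ = specNorm A := by
  simp only [specNorm_eq]
  rw [← Matrix.conjTranspose_eq_transpose_of_trivial]; exact Matrix.l2_opNorm_conjTranspose A

theorem specNorm_orth {N : ℕ} (Φ : Matrix (Fin N) (Fin N) ℝ) (h : IsOrthogonal Φ) :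
    specNorm Φ ≤ 1 := by
  have h1 := Matrix.l2_opNorm_conjTranspose_mul_self Φ
  rw [Matrix.conjTranspose_eq_transpose_of_trivial, h] at h1
  have h2 : ‖(1 : Matrix (Fin N) (Fin N) ℝ)‖ ≤ 1 := by
    rw [← Matrix.diagonal_one, Matrix.l2_opNorm_diagonal]
    exact (pi_norm_le_iff_of_nonneg zero_le_one).2 (by simp)
  rw [specNorm_eq]
  nlinarith [norm_nonneg Φ]

theorem cover_mat {a b : ℕ} (S : Set (Matrix (Fin a) (Fin b) ℝ)) (hS : S.Nonempty)
    (R c ε : ℝ) (hR : 0 ≤ R) (hc : 0 ≤ c)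
    (hε : 0 < ε) (hSR : ∀ x ∈ S, specNorm x ≤ R) :
    ∃ t : Finset (Matrix (Fin a) (Fin b) ℝ), (∀ x ∈ t, x ∈ S) ∧
      (∀ x ∈ S, ∃ y ∈ t, c * specNorm (x - y) ≤ ε) ∧
      (t.card : ℝ) ≤ (1 + 2 * R * c / ε) ^ (a * b) := by
  have := exists_cover_aux S hS R c ε hR hc hε hSR
  rw [Module.finrank_matrix] at this
  simpa [specNorm_eq] using this

end spec

section frob

theorem frobNorm_nonneg {a b : ℕ} (A : Matrix (Fin a) (Fin b) ℝ) : 0 ≤ frobNorm A :=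
  Real.sqrt_nonneg _

theorem frobNorm_sq {a b : ℕ} (A : Matrix (Fin a) (Fin b) ℝ) :
    frobNorm A ^ 2 = ∑ i, ∑ j, A i j ^ 2 := by
  rw [frobNorm, Real.sq_sqrt]; positivity

open scoped Matrix.Norms.Frobenius in
theorem frobNorm_eq {a b : ℕ} (A : Matrix (Fin a) (Fin b) ℝ) : frobNorm A = ‖A‖ := by
  rw [Matrix.frobenius_norm_def, frobNorm, Real.sqrt_eq_rpow]
  simp

open scoped Matrix.Norms.Frobenius in
theorem frobNorm_add {a b : ℕ} (A B : Matrix (Fin a) (Fin b) ℝ) :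
    frobNorm (A + B) ≤ frobNorm A + frobNorm B := by
  simp only [frobNorm_eq]; exact norm_add_le _ _

open scoped Matrix.Norms.Frobenius in
theorem frobNorm_smul {a b : ℕ} (c : ℝ) (hc : 0 ≤ c) (A : Matrix (Fin a) (Fin b) ℝ) :
    frobNorm (c • A) = c * frobNorm A := by
  simp only [frobNorm_eq]; rw [norm_smul, Real.norm_of_nonneg hc]

theorem frobNorm_zero {a b : ℕ} : frobNorm (0 : Matrix (Fin a) (Fin b) ℝ) = 0 := by
  simp [frobNorm]

theorem frobNorm_sq_col {a b : ℕ} (A : Matrix (Fin a) (Fin b) ℝ) :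
    frobNorm A ^ 2 = ∑ j, ‖WithLp.toLp 2 (fun i => A i j)‖ ^ 2 := by
  rw [frobNorm_sq, Finset.sum_comm]
  simp [EuclideanSpace.norm_sq_eq]

theorem frobNorm_mul {a b c : ℕ} (A : Matrix (Fin a) (Fin b) ℝ) (B : Matrix (Fin b) (Fin c) ℝ) :
    frobNorm (A * B) ≤ specNorm A * frobNorm B := by
  refine le_of_sq_le_sq ?_ (mul_nonneg (specNorm_nonneg _) (frobNorm_nonneg _))
  rw [mul_pow, frobNorm_sq_col, frobNorm_sq_col, Finset.mul_sum]
  refine Finset.sum_le_sum fun j _ => ?_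
  rw [← mul_pow]
  refine pow_le_pow_left₀ (norm_nonneg _) ?_ 2
  exact (LinearMap.toContinuousLinearMap (Matrix.toEuclideanLin A)).le_opNorm
    (WithLp.toLp 2 (fun i => B i j))

theorem soft_lip (mu : ℝ) (hmu : 0 ≤ mu) (x y : ℝ) : |soft mu x - soft mu y| ≤ |x - y| := by
  have form : ∀ z, soft mu z = max 0 (z - mu) - max 0 (-z - mu) := by
    intro z
    unfold soft
    rcases lt_trichotomy z 0 with h | h | h
    · rw [Real.sign_of_neg h, abs_of_neg h, max_eq_left (by linarith : z - mu ≤ 0)]; ring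
    · subst h; simp
    · rw [Real.sign_of_pos h, abs_of_pos h, max_eq_left (by linarith : -z - mu ≤ 0)]; ring
  rw [form, form]
  rcases max_cases 0 (x - mu) with h1 | h1 <;> rcases max_cases 0 (-x - mu) with h2 | h2 <;>
  rcases max_cases 0 (y - mu) with h3 | h3 <;> rcases max_cases 0 (-y - mu) with h4 | h4 <;>
  rw [h1.1, h2.1, h3.1, h4.1] <;> rw [abs_le] <;>
  rcases abs_cases (x - y) with h5 | h5 <;> constructor <;> linarith

theorem softMat_lip {a b : ℕ} (mu : ℝ) (hmu : 0 ≤ mu) (A B : Matrix (Fin a) (Fin b) ℝ) :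
    frobNorm (softMat mu A - softMat mu B) ≤ frobNorm (A - B) := by
  refine Real.sqrt_le_sqrt (Finset.sum_le_sum fun i _ => Finset.sum_le_sum fun j _ => ?_)
  exact sq_le_sq.2 (soft_lip mu hmu (A i j) (B i j))

theorem softMat_zero {a b : ℕ} (mu : ℝ) : softMat mu (0 : Matrix (Fin a) (Fin b) ℝ) = 0 := by
  ext i j; simp [softMat, soft]

theorem l2_eq {N : ℕ} (x : Fin N → ℝ) : l2 x = ‖WithLp.toLp 2 x‖ := by
  simp [l2, EuclideanSpace.norm_eq]

theorem ball_proj_lip {E : Type*} [NormedAddCommGroup E] [InnerProductSpace ℝ E] (B : ℝ)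
    (hB : 0 < B) (x y : E) :
    ‖(if ‖x‖ ≤ B then x else (B / ‖x‖) • x) - (if ‖y‖ ≤ B then y else (B / ‖y‖) • y)‖
      ≤ ‖x - y‖ := by
  have one : ∀ x y : E, ‖x‖ ≤ B → B < ‖y‖ → ‖x - (B / ‖y‖) • y‖ ≤ ‖x - y‖ := by
    intro x y hx hy
    have hy0 : 0 < ‖y‖ := hB.trans hy
    refine le_of_sq_le_sq ?_ (norm_nonneg _)
    rw [norm_sub_sq_real, norm_sub_sq_real, norm_smul, inner_smul_right,
      Real.norm_of_nonneg (by positivity), div_mul_cancel₀ _ hy0.ne']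
    have hc : B / ‖y‖ * ‖y‖ = B := div_mul_cancel₀ _ hy0.ne'
    have hc1 : B / ‖y‖ ≤ 1 := (div_le_one hy0).2 hy.le
    have hi : inner ℝ x y ≤ B * ‖y‖ :=
      (real_inner_le_norm x y).trans (mul_le_mul_of_nonneg_right hx hy0.le)
    have := mul_le_mul_of_nonneg_left hi (sub_nonneg.2 hc1)
    have e : (1 - B / ‖y‖) * (B * ‖y‖) = B * ‖y‖ - B * B := by
      rw [sub_mul, one_mul]; congr 1; rw [mul_left_comm, hc]
    rw [e] at this
    nlinarith
  by_cases hx : ‖x‖ ≤ B <;> by_cases hy : ‖y‖ ≤ B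
  · simp [hx, hy]
  · simp only [hx, hy, if_true, if_false]; exact one x y hx (not_le.1 hy)
  · simp only [hx, hy, if_true, if_false]
    rw [norm_sub_rev, norm_sub_rev x]; exact one y x hy (not_le.1 hx)
  · simp only [hx, hy, if_false]
    push Not at hx hy
    have hx0 : 0 < ‖x‖ := hB.trans hx
    have hy0 : 0 < ‖y‖ := hB.trans hy
    refine le_of_sq_le_sq ?_ (norm_nonneg _)
    rw [norm_sub_sq_real, norm_sub_sq_real, norm_smul, norm_smul, inner_smul_right,
      real_inner_smul_left, Real.norm_of_nonneg (by positivity),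
      Real.norm_of_nonneg (by positivity), div_mul_cancel₀ _ hy0.ne', div_mul_cancel₀ _ hx0.ne']
    have hc1 : B / ‖y‖ * (B / ‖x‖) ≤ 1 :=
      mul_le_one₀ ((div_le_one hy0).2 hy.le) (by positivity) ((div_le_one hx0).2 hx.le)
    have := mul_le_mul_of_nonneg_left (real_inner_le_norm x y) (sub_nonneg.2 hc1)
    have e : (1 - B / ‖y‖ * (B / ‖x‖)) * (‖x‖ * ‖y‖) = ‖x‖ * ‖y‖ - B * B := by
      field_simp
    rw [e] at this
    nlinarith [sq_nonneg (‖x‖ - ‖y‖)]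

theorem sigmaMat_lip {a b : ℕ} (B : ℝ) (hB : 0 < B) (X Z : Matrix (Fin a) (Fin b) ℝ) :
    frobNorm (sigmaMat B X - sigmaMat B Z) ≤ frobNorm (X - Z) := by
  have key : ∀ (M : Matrix (Fin a) (Fin b) ℝ) (j : Fin b),
      WithLp.toLp 2 (fun i => sigmaMat B M i j) =
      (if ‖WithLp.toLp 2 (fun i => M i j)‖ ≤ B then WithLp.toLp 2 (fun i => M i j)
        else (B / ‖WithLp.toLp 2 (fun i => M i j)‖) • WithLp.toLp 2 (fun i => M i j)) := by
    intro M j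
    rw [← l2_eq]
    have : (fun i => sigmaMat B M i j) = sigma B (fun k => M k j) := rfl
    rw [this, sigma]
    split_ifs <;> rfl
  refine le_of_sq_le_sq ?_ (frobNorm_nonneg _)
  rw [frobNorm_sq_col, frobNorm_sq_col]
  refine Finset.sum_le_sum fun j _ => pow_le_pow_left₀ (norm_nonneg _) ?_ 2
  have h := ball_proj_lip B hB (WithLp.toLp 2 (fun i => X i j)) (WithLp.toLp 2 (fun i => Z i j))
  rw [← key, ← key] at h
  exact h

end frob

section main

theorem spec_conj {n N : ℕ} (A : Matrix (Fin n) (Fin N) ℝ) (τ : ℝ)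
    {Φ : Matrix (Fin N) (Fin N) ℝ} (h : IsOrthogonal Φ) :
    specNorm (1 - τ • (Φᵀ * Aᵀ * A * Φ)) ≤ specNorm (1 - τ • (Aᵀ * A)) := by
  have e : 1 - τ • (Φᵀ * Aᵀ * A * Φ) = Φᵀ * ((1 - τ • (Aᵀ * A)) * Φ) := by
    have h' : Φᵀ * Φ = 1 := h
    rw [Matrix.sub_mul, Matrix.mul_sub, Matrix.one_mul, h']
    simp [Matrix.mul_assoc]
  have hΦ := specNorm_orth Φ h
  have hΦt : specNorm Φᵀ ≤ 1 := by rw [specNorm_transpose]; exact hΦ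
  rw [e]
  calc _ ≤ specNorm Φᵀ * specNorm ((1 - τ • (Aᵀ * A)) * Φ) := specNorm_mul _ _
    _ ≤ 1 * specNorm ((1 - τ • (Aᵀ * A)) * Φ) :=
        mul_le_mul_of_nonneg_right hΦt (specNorm_nonneg _)
    _ = specNorm ((1 - τ • (Aᵀ * A)) * Φ) := one_mul _
    _ ≤ specNorm (1 - τ • (Aᵀ * A)) * specNorm Φ := specNorm_mul _ _
    _ ≤ specNorm (1 - τ • (Aᵀ * A)) * 1 := mul_le_mul_of_nonneg_left hΦ (specNorm_nonneg _)
    _ = _ := mul_one _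

theorem spec_AΦ {n N : ℕ} (A : Matrix (Fin n) (Fin N) ℝ)
    {Φ : Matrix (Fin N) (Fin N) ℝ} (h : IsOrthogonal Φ) : specNorm (A * Φ) ≤ specNorm A :=
  (specNorm_mul _ _).trans (mul_le_of_le_one_right (specNorm_nonneg _) (specNorm_orth Φ h))

theorem ML_succ {n N m : ℕ} (A : Matrix (Fin n) (Fin N) ℝ) (τ : ℝ)
    (Y : Matrix (Fin n) (Fin m) ℝ) (l : ℕ) :
    ML A τ Y (l + 1) = specNorm (1 - τ • (Aᵀ * A)) * ML A τ Y l + τ * (specNorm A * frobNorm Y) := by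
  unfold ML
  rw [Finset.sum_range_succ']
  simp only [pow_succ, pow_zero, ← Finset.sum_mul]
  ring

theorem ML_nonneg {n N m : ℕ} (A : Matrix (Fin n) (Fin N) ℝ) (τ : ℝ) (hτ : 0 < τ)
    (Y : Matrix (Fin n) (Fin m) ℝ) (l : ℕ) : 0 ≤ ML A τ Y l := by
  have := specNorm_nonneg A
  have := specNorm_nonneg (1 - τ • (Aᵀ * A))
  have := frobNorm_nonneg Y
  unfold ML; positivity

theorem KL_nonneg {n N m : ℕ} (A : Matrix (Fin n) (Fin N) ℝ) (τ : ℝ) (hτ : 0 < τ)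
    (Y : Matrix (Fin n) (Fin m) ℝ) (l : ℕ) : 0 ≤ KL A τ Y l := by
  have := specNorm_nonneg A
  have := specNorm_nonneg (1 - τ • (Aᵀ * A))
  have := frobNorm_nonneg Y
  unfold KL; positivity

theorem KL_one {n N m : ℕ} (A : Matrix (Fin n) (Fin N) ℝ) (τ : ℝ)
    (Y : Matrix (Fin n) (Fin m) ℝ) : KL A τ Y 1 = τ * frobNorm Y := by
  simp [KL]

theorem KL_succ {n N m : ℕ} (A : Matrix (Fin n) (Fin N) ℝ) (τ : ℝ)
    (Y : Matrix (Fin n) (Fin m) ℝ) (l : ℕ) (hl : 1 ≤ l) :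
    KL A τ Y (l + 1) = specNorm (1 - τ • (Aᵀ * A)) * KL A τ Y l +
      (τ * (2 * specNorm A * ML A τ Y l) + τ * frobNorm Y) := by
  unfold KL ML
  generalize specNorm (1 - τ • (Aᵀ * A)) = ρ
  rw [Finset.sum_Icc_succ_top (by omega)]
  have e : ∑ k ∈ Finset.Icc 2 l, ρ ^ (l + 1 - k) * (1 + 2 * τ * specNorm A ^ 2 *
      ∑ k ∈ Finset.range (k - 1), ρ ^ k) = ρ * ∑ k ∈ Finset.Icc 2 l, ρ ^ (l - k) *
      (1 + 2 * τ * specNorm A ^ 2 * ∑ k ∈ Finset.range (k - 1), ρ ^ k) := by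
    rw [Finset.mul_sum]
    refine Finset.sum_congr rfl fun k hk => ?_
    have : l + 1 - k = (l - k) + 1 := by have := (Finset.mem_Icc.1 hk).2; omega
    rw [this, pow_succ]; ring
  rw [e]
  obtain ⟨l, rfl⟩ : ∃ k, l = k + 1 := ⟨l - 1, by omega⟩
  simp only [Nat.add_sub_cancel, Nat.sub_self, pow_zero, pow_succ ρ l]
  ring

theorem ista_bound {n N m : ℕ} (A : Matrix (Fin n) (Fin N) ℝ)
    (τ lam : ℝ) (hτ : 0 < τ) (hlam : 0 < lam) (Y : Matrix (Fin n) (Fin m) ℝ)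
    {Φ : Matrix (Fin N) (Fin N) ℝ} (h : IsOrthogonal Φ) (l : ℕ) :
    frobNorm (ista A τ lam Φ Y l) ≤ ML A τ Y l := by
  induction l with
  | zero => simp [ista, ML, frobNorm_zero]
  | succ l ih =>
    rw [ML_succ, ista]
    have h1 := softMat_lip (τ * lam) (by positivity)
      ((1 - τ • (Φᵀ * Aᵀ * A * Φ)) * ista A τ lam Φ Y l + τ • ((A * Φ)ᵀ * Y)) 0
    rw [softMat_zero, sub_zero, sub_zero] at h1
    refine h1.trans ((frobNorm_add _ _).trans (add_le_add ?_ ?_))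
    · exact (frobNorm_mul _ _).trans (mul_le_mul (spec_conj A τ h) ih (frobNorm_nonneg _)
        (specNorm_nonneg _))
    · rw [frobNorm_smul _ hτ.le]
      refine mul_le_mul_of_nonneg_left ((frobNorm_mul _ _).trans ?_) hτ.le
      refine mul_le_mul_of_nonneg_right ?_ (frobNorm_nonneg _)
      rw [specNorm_transpose]; exact spec_AΦ A h

theorem gram_diff {n N : ℕ} (B C : Matrix (Fin n) (Fin N) ℝ) (a : ℝ)
    (hB : specNorm B ≤ a) (hC : specNorm C ≤ a) :
    specNorm (Cᵀ * C - Bᵀ * B) ≤ 2 * a * specNorm (B - C) := by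
  have e : Cᵀ * C - Bᵀ * B = Cᵀ * (C - B) + (C - B)ᵀ * B := by
    rw [Matrix.transpose_sub, Matrix.mul_sub, Matrix.sub_mul]; abel
  have d := specNorm_nonneg (C - B)
  rw [e, specNorm_sub_rev B C]
  have h1 := specNorm_mul Cᵀ (C - B)
  have h2 := specNorm_mul (C - B)ᵀ B
  rw [specNorm_transpose] at h1 h2
  have h3 := specNorm_add (Cᵀ * (C - B)) ((C - B)ᵀ * B)
  have h4 := mul_le_mul_of_nonneg_right hC d
  have h5 := mul_le_mul_of_nonneg_left hB d
  linarith

theorem ista_lip {n N m : ℕ} (A : Matrix (Fin n) (Fin N) ℝ)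
    (τ lam : ℝ) (hτ : 0 < τ) (hlam : 0 < lam) (Y : Matrix (Fin n) (Fin m) ℝ)
    {Φ Θ : Matrix (Fin N) (Fin N) ℝ} (h : IsOrthogonal Φ) (h' : IsOrthogonal Θ) (l : ℕ)
    (hl : 1 ≤ l) :
    frobNorm (ista A τ lam Φ Y l - ista A τ lam Θ Y l) ≤
      KL A τ Y l * specNorm (A * Φ - A * Θ) := by
  have hY : frobNorm (τ • ((A * Φ)ᵀ * Y) - τ • ((A * Θ)ᵀ * Y)) ≤
      τ * frobNorm Y * specNorm (A * Φ - A * Θ) := by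
    rw [← smul_sub, ← Matrix.sub_mul, ← Matrix.transpose_sub, frobNorm_smul _ hτ.le, mul_assoc]
    refine mul_le_mul_of_nonneg_left ((frobNorm_mul _ _).trans ?_) hτ.le
    rw [specNorm_transpose, mul_comm]
  induction l, hl using Nat.le_induction with
  | base =>
    rw [KL_one]
    refine (softMat_lip (τ * lam) (by positivity) _ _).trans ?_
    simpa [ista] using hY
  | succ l hl ih =>
    rw [KL_succ _ _ _ _ hl, ista, ista]
    refine (softMat_lip (τ * lam) (by positivity) _ _).trans ?_
    set F := ista A τ lam Φ Y l
    set G := ista A τ lam Θ Y l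
    have e : (1 - τ • (Φᵀ * Aᵀ * A * Φ)) * F + τ • ((A * Φ)ᵀ * Y) -
        ((1 - τ • (Θᵀ * Aᵀ * A * Θ)) * G + τ • ((A * Θ)ᵀ * Y)) =
        (1 - τ • (Φᵀ * Aᵀ * A * Φ)) * (F - G) +
        (τ • (((A * Θ)ᵀ * (A * Θ) - (A * Φ)ᵀ * (A * Φ)) * G) +
          (τ • ((A * Φ)ᵀ * Y) - τ • ((A * Θ)ᵀ * Y))) := by
      simp only [Matrix.transpose_mul, Matrix.sub_mul, Matrix.mul_sub, Matrix.mul_assoc,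
        Matrix.smul_mul, smul_sub, Matrix.one_mul]
      abel
    rw [e, add_mul, add_mul]
    refine (frobNorm_add _ _).trans (add_le_add ?_ ((frobNorm_add _ _).trans (add_le_add ?_ hY)))
    · rw [mul_assoc]
      exact (frobNorm_mul _ _).trans (mul_le_mul (spec_conj A τ h) ih (frobNorm_nonneg _)
        (specNorm_nonneg _))
    · rw [frobNorm_smul _ hτ.le, mul_assoc]
      refine mul_le_mul_of_nonneg_left ((frobNorm_mul _ _).trans ?_) hτ.le
      have h1 := gram_diff (A * Φ) (A * Θ) (specNorm A) (spec_AΦ A h) (spec_AΦ A h')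
      have h2 := ista_bound A τ lam hτ hlam Y h' l
      refine (mul_le_mul h1 h2 (frobNorm_nonneg _) ((specNorm_nonneg _).trans h1)).trans ?_
      apply le_of_eq; ring

end main

theorem statement13 {n N m : ℕ} (A : Matrix (Fin n) (Fin N) ℝ)
    (τ lam : ℝ) (hτ : 0 < τ) (hlam : 0 < lam)
    (Y : Matrix (Fin n) (Fin m) ℝ) (L : ℕ) (hL : 2 ≤ L) (Bout : ℝ) (hBout : 0 < Bout)
    (ε : ℝ) (hε : 0 < ε) :
    coveringNumber (fun M M' : Matrix (Fin N) (Fin m) ℝ => frobNorm (M - M'))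
      {M | ∃ Ψ : Matrix (Fin N) (Fin N) ℝ, IsOrthogonal Ψ ∧
        ∃ Φ : Matrix (Fin N) (Fin N) ℝ, IsOrthogonal Φ ∧
          M = sigmaMat Bout (Ψ * ista A τ lam Φ Y L)} ε ≤
      ENNReal.ofReal (Real.exp ((N : ℝ) ^ 2 * Real.log (1 + 4 * ML A τ Y L / ε) +
        (n : ℝ) * (N : ℝ) * Real.log (1 + 4 * specNorm A * KL A τ Y L / ε))) := by
  classical
  have hA := specNorm_nonneg A
  have hM := ML_nonneg A τ hτ Y L
  have hK := KL_nonneg A τ hτ Y L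
  obtain ⟨t₁, ht₁, hc₁, hn₁⟩ := cover_mat {Ψ : Matrix (Fin N) (Fin N) ℝ | IsOrthogonal Ψ}
    ⟨1, by simp [IsOrthogonal]⟩ 1 (ML A τ Y L) (ε / 2) zero_le_one hM (by positivity)
    (fun x hx => specNorm_orth x hx)
  obtain ⟨t₂, ht₂, hc₂, hn₂⟩ := cover_mat
    {B : Matrix (Fin n) (Fin N) ℝ | ∃ Φ : Matrix (Fin N) (Fin N) ℝ, IsOrthogonal Φ ∧ A * Φ = B}
    ⟨A, 1, by simp [IsOrthogonal], by simp⟩ (specNorm A) (KL A τ Y L) (ε / 2) hA hK (by positivity)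
    (by rintro x ⟨Φ, hΦ, rfl⟩; exact spec_AΦ A hΦ)
  choose! φ hφ hφA using ht₂
  let t := Finset.image₂ (fun Ψ B => sigmaMat Bout (Ψ * ista A τ lam (φ B) Y L)) t₁ t₂
  have hcov : ∀ x ∈ {M | ∃ Ψ : Matrix (Fin N) (Fin N) ℝ, IsOrthogonal Ψ ∧
        ∃ Φ : Matrix (Fin N) (Fin N) ℝ, IsOrthogonal Φ ∧
          M = sigmaMat Bout (Ψ * ista A τ lam Φ Y L)}, ∃ y ∈ t, frobNorm (x - y) ≤ ε := by
    rintro _ ⟨Ψ, hΨ, Φ, hΦ, rfl⟩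
    obtain ⟨Ψ', hΨ', h1⟩ := hc₁ Ψ hΨ
    obtain ⟨B, hB, h2⟩ := hc₂ (A * Φ) ⟨Φ, hΦ, rfl⟩
    refine ⟨_, Finset.mem_image₂_of_mem hΨ' hB, (sigmaMat_lip Bout hBout _ _).trans ?_⟩
    have e : Ψ * ista A τ lam Φ Y L - Ψ' * ista A τ lam (φ B) Y L =
        (Ψ - Ψ') * ista A τ lam Φ Y L + Ψ' * (ista A τ lam Φ Y L - ista A τ lam (φ B) Y L) := by
      rw [Matrix.sub_mul, Matrix.mul_sub]; abel
    rw [e]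
    have h3 := ista_lip A τ lam hτ hlam Y hΦ (hφ B hB) L (by omega)
    rw [hφA B hB] at h3
    have h4 := ista_bound A τ lam hτ hlam Y hΦ L
    have h5 := frobNorm_mul (Ψ - Ψ') (ista A τ lam Φ Y L)
    have h6 := frobNorm_mul Ψ' (ista A τ lam Φ Y L - ista A τ lam (φ B) Y L)
    have h7 := mul_le_mul_of_nonneg_left h4 (specNorm_nonneg (Ψ - Ψ'))
    have h8 := mul_le_of_le_one_left
      (frobNorm_nonneg (ista A τ lam Φ Y L - ista A τ lam (φ B) Y L)) (specNorm_orth Ψ' (ht₁ Ψ' hΨ'))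
    have h9 := frobNorm_add ((Ψ - Ψ') * ista A τ lam Φ Y L)
      (Ψ' * (ista A τ lam Φ Y L - ista A τ lam (φ B) Y L))
    linarith
  unfold coveringNumber
  refine (iInf₂_le t hcov).trans ?_
  have hcard : (t.card : ℝ) ≤ (t₁.card : ℝ) * (t₂.card : ℝ) := by
    exact_mod_cast Finset.card_image₂_le _ t₁ t₂
  have p1 : 0 < 1 + 4 * ML A τ Y L / ε := by positivity
  have p2 : 0 < 1 + 4 * specNorm A * KL A τ Y L / ε := by positivity
  have hexp : Real.exp ((N : ℝ) ^ 2 * Real.log (1 + 4 * ML A τ Y L / ε) +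
        (n : ℝ) * (N : ℝ) * Real.log (1 + 4 * specNorm A * KL A τ Y L / ε)) =
      (1 + 4 * ML A τ Y L / ε) ^ (N * N) * (1 + 4 * specNorm A * KL A τ Y L / ε) ^ (n * N) := by
    rw [Real.exp_add]
    congr 1
    · rw [← Real.exp_log p1, ← Real.exp_nat_mul, Real.exp_log p1]
      congr 2; push_cast; ring
    · rw [← Real.exp_log p2, ← Real.exp_nat_mul, Real.exp_log p2]
      congr 2; push_cast; ring
  have e1 : 1 + 2 * 1 * ML A τ Y L / (ε / 2) = 1 + 4 * ML A τ Y L / ε := by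
    field_simp; ring
  have e2 : 1 + 2 * specNorm A * KL A τ Y L / (ε / 2) = 1 + 4 * specNorm A * KL A τ Y L / ε := by
    field_simp; ring
  rw [e1] at hn₁
  rw [e2] at hn₂
  rw [hexp, ← ENNReal.ofReal_natCast]
  exact ENNReal.ofReal_le_ofReal (hcard.trans (mul_le_mul hn₁ hn₂ (by positivity) (by positivity)))
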